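/- Consider a finite discounted MO-MDP with initial distribution μ satisfying μ(s) > 0 for every state s. Let F = J(μ) ∩ {x ∈ ℝ^D : wᵀx = c} be a face of J(μ), i.e., wᵀy ≤ c for all y ∈ J(μ). Let Π_F = {π : π a deterministic stationary policy with J^π(μ) ∈ F}. Then F is exactly the set of returns of convex combinations of policies in Π_F: F = {J^π(μ) : π(s,a) = Σ_{π_i ∈ Π_F} α_i π_i(s,a) for all s,a, with α_i ≥ 0 and Σ_i α_i = 1}. -/

import Mathlib

open Finset

/-- A stationary policy: nonnegative and sums to one at every state. -/
def IsPolicy {S A : Type*} [Fintype A] (π : S → A → ℝ) : Prop :=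
  (∀ s a, 0 ≤ π s a) ∧ (∀ s, ∑ a, π s a = 1)

/-- A deterministic stationary policy. -/
def IsDetPolicy {S A : Type*} [Fintype A] (π : S → A → ℝ) : Prop :=
  IsPolicy π ∧ ∀ s, ∃ a, π s a = 1

/-- A solution of a discounted linear system with nonnegative source dominates the source. -/
theorem le_of_discounted_eq {S : Type*} [Fintype S] [Nonempty S] {K : S → S → ℝ}
    (hK0 : ∀ s s', 0 ≤ K s s') (hK1 : ∀ s, ∑ s', K s s' = 1) {γ : ℝ} (hγ0 : 0 ≤ γ) (hγ1 : γ < 1)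
    {d g : S → ℝ} (hg : ∀ s, 0 ≤ g s) (hd : ∀ s, d s = g s + γ * ∑ s', K s s' * d s') (s : S) :
    g s ≤ d s := by
  obtain ⟨m, hm⟩ := Finite.exists_min d
  have hmean : d m ≤ ∑ s', K m s' * d s' := by
    calc d m = ∑ s', K m s' * d m := by rw [← Finset.sum_mul, hK1, one_mul]
      _ ≤ _ := Finset.sum_le_sum fun s' _ => mul_le_mul_of_nonneg_left (hm s') (hK0 m s')
  have hm0 : 0 ≤ d m := by
    have h := hd m
    have := mul_le_mul_of_nonneg_left hmean hγ0
    nlinarith [hg m]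
  have : 0 ≤ γ * ∑ s', K s s' * d s' :=
    mul_nonneg hγ0 (Finset.sum_nonneg fun s' _ => mul_nonneg (hK0 s s') (hm0.trans (hm s')))
  linarith [hd s]

/-- The scalar value of acting once and then receiving the continuation `v`. -/
def actionValue {S A : Type*} [Fintype S] (P : S → A → S → ℝ) (ρ : S → A → ℝ) (γ : ℝ)
    (v : S → ℝ) (s : S) (a : A) : ℝ :=
  ρ s a + γ * ∑ s', P s a s' * v s'

/-- The difference between the value of a policy and an arbitrary `v` solves the discounted
system whose source is the expected one-step advantage over `v`. -/
theorem value_sub_eq_advantage_add {S A : Type*} [Fintype S] [Fintype A]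
    {P : S → A → S → ℝ} {ρ : S → A → ℝ} {γ : ℝ} {π : S → A → ℝ} (hπ : IsPolicy π)
    {u : S → ℝ} (hu : ∀ s, u s = ∑ a, π s a * actionValue P ρ γ u s a) (v : S → ℝ) (s : S) :
    u s - v s = ∑ a, π s a * (actionValue P ρ γ v s a - v s) +
      γ * ∑ s', (∑ a, π s a * P s a s') * (u s' - v s') := by
  have h : γ * ∑ s', (∑ a, π s a * P s a s') * (u s' - v s') =
      ∑ a, π s a * (actionValue P ρ γ u s a - actionValue P ρ γ v s a) := by
    simp only [actionValue, add_sub_add_left_eq_sub, ← mul_sub, ← Finset.sum_sub_distrib,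
      Finset.sum_mul]
    rw [Finset.sum_comm, Finset.mul_sum]
    refine Finset.sum_congr rfl fun a _ => ?_
    rw [mul_left_comm, Finset.mul_sum (a := π s a)]
    simp only [mul_assoc]
  rw [h, ← Finset.sum_add_distrib]
  calc u s - v s = (∑ a, π s a * actionValue P ρ γ u s a) - ∑ a, π s a * v s := by
        rw [← hu, ← Finset.sum_mul, hπ.2, one_mul]
    _ = _ := by
        rw [← Finset.sum_sub_distrib]
        exact Finset.sum_congr rfl fun a _ => by ring

theorem IsPolicy.sum_transition_nonneg {S A : Type*} [Fintype A] {P : S → A → S → ℝ}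
    (hP0 : ∀ s a s', 0 ≤ P s a s') {π : S → A → ℝ} (hπ : IsPolicy π) (s s' : S) :
    0 ≤ ∑ a, π s a * P s a s' :=
  Finset.sum_nonneg fun a _ => mul_nonneg (hπ.1 s a) (hP0 s a s')

theorem IsPolicy.sum_transition_eq_one {S A : Type*} [Fintype S] [Fintype A]
    {P : S → A → S → ℝ} (hP1 : ∀ s a, ∑ s', P s a s' = 1)
    {π : S → A → ℝ} (hπ : IsPolicy π) (s : S) :
    ∑ s', ∑ a, π s a * P s a s' = 1 := by
  rw [Finset.sum_comm]
  simp only [← Finset.mul_sum, hP1, mul_one, hπ.2]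

theorem isPolicy_update_single {S A : Type*} [Fintype A] [DecidableEq S] [DecidableEq A]
    {π : S → A → ℝ} (hπ : IsPolicy π) (s : S) (a : A) :
    IsPolicy (Function.update π s (Pi.single a 1)) := by
  refine ⟨fun t b => ?_, fun t => ?_⟩ <;> rcases eq_or_ne t s with rfl | ht
  · rw [Function.update_self, Pi.single_apply]; split_ifs <;> norm_num
  · rw [Function.update_of_ne ht]; exact hπ.1 t b
  · simp
  · rw [Function.update_of_ne ht]; exact hπ.2 t

/-- If `v` is the value of a policy maximizing the return, no action improves on `v`. -/
theorem actionValue_le_of_optimal {S A : Type*} [Fintype S] [Fintype A] [Nonempty S]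
    {P : S → A → S → ℝ} (hP0 : ∀ s a s', 0 ≤ P s a s') (hP1 : ∀ s a, ∑ s', P s a s' = 1)
    {ρ : S → A → ℝ} {γ : ℝ} (hγ0 : 0 ≤ γ) (hγ1 : γ < 1) {μ : S → ℝ} (hμ : ∀ s, 0 < μ s)
    {U : (S → A → ℝ) → S → ℝ}
    (hU : ∀ π, IsPolicy π → ∀ s, U π s = ∑ a, π s a * actionValue P ρ γ (U π) s a)
    {π₀ : S → A → ℝ} (hπ₀ : IsPolicy π₀)
    (hmax : ∀ π, IsPolicy π → ∑ s, μ s * U π s ≤ ∑ s, μ s * U π₀ s) (s : S) (a : A) :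
    actionValue P ρ γ (U π₀) s a ≤ U π₀ s := by
  classical
  by_contra! hlt
  have hπ := isPolicy_update_single hπ₀ s a
  set π := Function.update π₀ s (Pi.single a 1) with hπdef
  have hgs : ∑ b, π s b * (actionValue P ρ γ (U π₀) s b - U π₀ s) =
      actionValue P ρ γ (U π₀) s a - U π₀ s := by
    simp [hπdef, Pi.single_apply]
  have hg : ∀ t, 0 ≤ ∑ b, π t b * (actionValue P ρ γ (U π₀) t b - U π₀ t) := by
    intro t
    rcases eq_or_ne t s with rfl | ht
    · rw [hgs]; linarith
    · simp only [hπdef, Function.update_of_ne ht, mul_sub, Finset.sum_sub_distrib]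
      rw [← hU π₀ hπ₀, ← Finset.sum_mul, hπ₀.2]
      simp
  have hd := le_of_discounted_eq (hπ.sum_transition_nonneg hP0) (hπ.sum_transition_eq_one hP1)
    hγ0 hγ1 hg (value_sub_eq_advantage_add hπ (hU π hπ) (U π₀))
  refine (hmax π hπ).not_gt (Finset.sum_lt_sum (fun t _ => ?_) ⟨s, Finset.mem_univ s, ?_⟩)
  · exact mul_le_mul_of_nonneg_left (by linarith [hd t, hg t]) (hμ t).le
  · exact mul_lt_mul_of_pos_left (by linarith [hd s]) (hμ s)

/-- The policies attaining the maximal return are those supported on actions that are greedy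
with respect to the optimal value. -/
theorem return_eq_iff_support_greedy {S A : Type*} [Fintype S] [Fintype A] [Nonempty S]
    {P : S → A → S → ℝ} (hP0 : ∀ s a s', 0 ≤ P s a s') (hP1 : ∀ s a, ∑ s', P s a s' = 1)
    {ρ : S → A → ℝ} {γ : ℝ} (hγ0 : 0 ≤ γ) (hγ1 : γ < 1) {μ : S → ℝ} (hμ : ∀ s, 0 < μ s)
    {U : (S → A → ℝ) → S → ℝ}
    (hU : ∀ π, IsPolicy π → ∀ s, U π s = ∑ a, π s a * actionValue P ρ γ (U π) s a)
    {π₀ : S → A → ℝ} (hπ₀ : IsPolicy π₀)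
    (hmax : ∀ π, IsPolicy π → ∑ s, μ s * U π s ≤ ∑ s, μ s * U π₀ s)
    {π : S → A → ℝ} (hπ : IsPolicy π) :
    ∑ s, μ s * U π s = ∑ s, μ s * U π₀ s ↔
      ∀ s a, π s a ≠ 0 → actionValue P ρ γ (U π₀) s a = U π₀ s := by
  have hle := actionValue_le_of_optimal hP0 hP1 hγ0 hγ1 hμ hU hπ₀ hmax
  have hterm : ∀ s a, 0 ≤ π s a * (U π₀ s - actionValue P ρ γ (U π₀) s a) := fun s a =>
    mul_nonneg (hπ.1 s a) (sub_nonneg.2 (hle s a))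
  have hg : ∀ s, 0 ≤ ∑ a, π s a * (U π₀ s - actionValue P ρ γ (U π₀) s a) := fun s =>
    Finset.sum_nonneg fun a _ => hterm s a
  have hadv := value_sub_eq_advantage_add hπ (hU π hπ) (U π₀)
  have hdom := le_of_discounted_eq (hπ.sum_transition_nonneg hP0) (hπ.sum_transition_eq_one hP1)
    hγ0 hγ1 (d := fun s => U π₀ s - U π s) hg fun s => by
      have h := congrArg Neg.neg (hadv s)
      simpa only [neg_add, neg_sub, ← mul_neg, ← Finset.sum_neg_distrib] using h
  constructor
  · intro heq s a hne
    have hsum : ∑ t, μ t * (U π₀ t - U π t) = 0 := by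
      simp only [mul_sub, Finset.sum_sub_distrib, heq, sub_self]
    have hs := (Finset.sum_eq_zero_iff_of_nonneg fun t _ =>
      mul_nonneg (hμ t).le ((hg t).trans (hdom t))).1 hsum s (Finset.mem_univ s)
    have hds := (mul_eq_zero.1 hs).resolve_left (hμ s).ne'
    have hzero := (Finset.sum_eq_zero_iff_of_nonneg fun b _ => hterm s b).1
      (le_antisymm ((hdom s).trans hds.le) (hg s)) a (Finset.mem_univ a)
    linarith [(mul_eq_zero.1 hzero).resolve_left hne]
  · intro hsupp
    have hzero : ∀ s, ∑ a, π s a * (actionValue P ρ γ (U π₀) s a - U π₀ s) = 0 := fun s =>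
      Finset.sum_eq_zero fun a _ => by
        by_cases h : π s a = 0
        · rw [h, zero_mul]
        · rw [hsupp s a h, sub_self, mul_zero]
    have hge := le_of_discounted_eq (hπ.sum_transition_nonneg hP0)
      (hπ.sum_transition_eq_one hP1) hγ0 hγ1 (fun s => (hzero s).ge) hadv
    refine (hmax π hπ).antisymm (Finset.sum_le_sum fun s _ =>
      mul_le_mul_of_nonneg_left ?_ (hμ s).le)
    linarith [hge s, hzero s]

/-- The policies choosing only actions allowed by `O`. -/
def policiesOn {S A : Type*} [Fintype A] (O : S → Set A) : Set (S → A → ℝ) :=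
  {π | IsPolicy π ∧ ∀ s a, π s a ≠ 0 → a ∈ O s}

theorem convex_policiesOn {S A : Type*} [Fintype A] (O : S → Set A) :
    Convex ℝ (policiesOn O) := by
  rintro π ⟨hπ, hπO⟩ π' ⟨hπ', hπO'⟩ a b ha hb hab
  refine ⟨⟨fun s x => ?_, fun s => ?_⟩, fun s x hx => ?_⟩
  · exact add_nonneg (mul_nonneg ha (hπ.1 s x)) (mul_nonneg hb (hπ'.1 s x))
  · simp [Finset.sum_add_distrib, ← Finset.mul_sum, hπ.2, hπ'.2, hab]
  · by_contra hxO
    have h : π s x = 0 := by_contra fun h => hxO (hπO s x h)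
    have h' : π' s x = 0 := by_contra fun h => hxO (hπO' s x h)
    simp [h, h'] at hx

/-- Every policy with allowed actions is a convex combination of deterministic ones. -/
theorem policiesOn_subset_convexHull {S A : Type*} [Fintype S] [Fintype A] (O : S → Set A) :
    policiesOn O ⊆ convexHull ℝ {π | IsDetPolicy π ∧ π ∈ policiesOn O} := by
  classical
  rintro π ⟨hπ, hπO⟩
  let E : S → Set (A → ℝ) := fun s => (fun a => Pi.single a 1) '' O s
  have hpi : π ∈ convexHull ℝ (Set.univ.pi E) := by
    rw [convexHull_pi]
    intro s _
    have hs : π s = ∑ a with π s a ≠ 0, π s a • (Pi.single a 1 : A → ℝ) := by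
      rw [Finset.sum_filter_of_ne (by rintro a - h h0; exact h (by rw [h0, zero_smul]))]
      exact pi_eq_sum_univ' (π s)
    rw [hs]
    refine (convex_convexHull ℝ _).sum_mem (fun a _ => hπ.1 s a) ?_ fun a ha =>
      subset_convexHull ℝ _ ⟨a, hπO s a (Finset.mem_filter.1 ha).2, rfl⟩
    rw [Finset.sum_filter_ne_zero, hπ.2]
  refine convexHull_mono (fun δ hδ => ?_) hpi
  choose f hfO hf using fun s => hδ s (Set.mem_univ s)
  obtain rfl : (fun s => Pi.single (f s) 1) = δ := funext hf
  have hpol : IsPolicy fun s => (Pi.single (f s) 1 : A → ℝ) :=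
    ⟨fun s a => by simp only [Pi.single_apply]; split_ifs <;> norm_num, fun s => by simp⟩
  refine ⟨⟨hpol, fun s => ⟨f s, Pi.single_eq_same _ _⟩⟩, hpol, fun s a ha => ?_⟩
  obtain rfl : a = f s := by_contra fun h => ha (Pi.single_eq_of_ne h _)
  exact hfO s

/-- A face `F` of `J(μ)` is exactly the set of returns of convex combinations of the
deterministic policies whose returns lie in `F`. -/
theorem face_eq_returns_of_convex_combinations
    {S A : Type*} [Fintype S] [Fintype A] [Nonempty S] [Nonempty A]
    {D : ℕ} (hD : 1 ≤ D)
    (P : S → A → S → ℝ)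
    (hP0 : ∀ s a s', 0 ≤ P s a s') (hP1 : ∀ s a, ∑ s', P s a s' = 1)
    (r : S → A → Fin D → ℝ)
    (γ : ℝ) (hγ0 : 0 ≤ γ) (hγ1 : γ < 1)
    (μ : S → ℝ) (hμpos : ∀ s, 0 < μ s) (hμ1 : ∑ s, μ s = 1)
    (V : (S → A → ℝ) → S → Fin D → ℝ)
    (hV : ∀ π : S → A → ℝ, IsPolicy π → ∀ s,
      V π s = (∑ a, π s a • r s a) + γ • ∑ s', (∑ a, π s a * P s a s') • V π s')
    (J : (S → A → ℝ) → Fin D → ℝ) (hJ : ∀ π, J π = ∑ s, μ s • V π s)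
    (Jset : Set (Fin D → ℝ))
    (hJset : Jset = {x | ∃ π, IsPolicy π ∧ x = J π})
    (w : Fin D → ℝ) (c : ℝ)
    (hw : ∀ y ∈ Jset, ∑ i, w i * y i ≤ c)
    (F : Set (Fin D → ℝ)) (hF : F = Jset ∩ {x | ∑ i, w i * x i = c})
    (PolF : Set (S → A → ℝ))
    (hPolF : PolF = {π | IsDetPolicy π ∧ J π ∈ F}) :
    F = {x | ∃ π ∈ convexHull ℝ PolF, x = J π} := by
  let L : (Fin D → ℝ) →ₗ[ℝ] ℝ := ∑ i, w i • LinearMap.proj i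
  have hL : ∀ x, L x = ∑ i, w i * x i := fun x => by simp [L]
  have hU : ∀ π, IsPolicy π → ∀ s, L (V π s) =
      ∑ a, π s a * actionValue P (fun s a => L (r s a)) γ (fun s => L (V π s)) s a := by
    intro π hπ s
    rw [hV π hπ s]
    simp only [map_add, map_sum, map_smul, smul_eq_mul, actionValue, mul_add,
      Finset.sum_add_distrib]
    congr 1
    simp only [Finset.sum_mul, Finset.mul_sum]
    rw [Finset.sum_comm]
    exact Finset.sum_congr rfl fun a _ => Finset.sum_congr rfl fun s' _ => by ring
  have hLJ : ∀ π, ∑ i, w i * J π i = ∑ s, μ s * L (V π s) := fun π => by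
    rw [← hL, hJ]; simp only [map_sum, map_smul, smul_eq_mul]
  have hmemF : ∀ π, IsPolicy π → (J π ∈ F ↔ ∑ s, μ s * L (V π s) = c) := fun π hπ => by
    rw [hF, hJset, ← hLJ]
    exact ⟨fun h => h.2, fun h => ⟨⟨π, hπ, rfl⟩, h⟩⟩
  have hface : ∀ π₀, IsPolicy π₀ → J π₀ ∈ F →
      ∃ O : S → Set A, ∀ π, IsPolicy π → (J π ∈ F ↔ π ∈ policiesOn O) := by
    intro π₀ hπ₀ h₀
    have hc := (hmemF π₀ hπ₀).1 h₀
    have hmax : ∀ π, IsPolicy π → ∑ s, μ s * L (V π s) ≤ ∑ s, μ s * L (V π₀ s) := by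
      intro π hπ
      rw [hc, ← hLJ]
      exact hw _ (hJset ▸ ⟨π, hπ, rfl⟩)
    refine ⟨fun s => {a | actionValue P (fun s a => L (r s a)) γ (fun s => L (V π₀ s)) s a =
      L (V π₀ s)}, fun π hπ => ?_⟩
    rw [hmemF π hπ, ← hc, return_eq_iff_support_greedy hP0 hP1 hγ0 hγ1 hμpos
      (U := fun π s => L (V π s)) hU hπ₀ hmax hπ]
    exact ⟨fun h => ⟨hπ, h⟩, fun h => h.2⟩
  ext x
  constructor
  · intro hx
    obtain ⟨π, hπ, rfl⟩ : ∃ π, IsPolicy π ∧ x = J π := by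
      rw [hF, hJset] at hx
      exact hx.1
    obtain ⟨O, hO⟩ := hface π hπ hx
    refine ⟨π, convexHull_mono ?_ (policiesOn_subset_convexHull O ((hO π hπ).1 hx)), rfl⟩
    rintro δ ⟨hδ, hδO⟩
    exact hPolF ▸ ⟨hδ, (hO δ hδ.1).2 hδO⟩
  · rintro ⟨π, hπ, rfl⟩
    obtain ⟨π₀, h₀⟩ := convexHull_nonempty_iff.1 ⟨π, hπ⟩
    rw [hPolF] at h₀
    obtain ⟨O, hO⟩ := hface π₀ h₀.1.1 h₀.2
    have hsub : PolF ⊆ policiesOn O := by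
      rw [hPolF]
      exact fun δ hδ => (hO δ hδ.1.1).1 hδ.2
    have hπO := convexHull_min hsub (convex_policiesOn O) hπ
    exact (hO π hπO.1).2 hπO
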